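/- Let K ≥ 1 and n = 2K+1, let m_1,…,m_n be positive real numbers, and for 1 ≤ j ≤ K define H_j on ℝ^n by H_j(x) = Σ_{I<J} (Π_{i∈I} m_i e^{x_i}) (Π_{k∈J} m_k e^{−x_k}), the sum running over pairs of j-element subsets I, J of {1,…,n} with I < J (interlacing). Then for all 1 ≤ i, j ≤ K, the Poisson bracket {H_i, H_j}(x) = 0 at every point x with x_1 < x_2 < ⋯ < x_n. -/

import Mathlib

open scoped Classical
open Finset

/-- The Poisson bracket `{f,g}(x) = ∑_{i<k} sgn(x_i - x_k)
(∂f/∂x_i ∂g/∂x_k - ∂f/∂x_k ∂g/∂x_i)` on `ℝ^n`. -/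
noncomputable def pb {n : ℕ} (f g : (Fin n → ℝ) → ℝ) (x : Fin n → ℝ) : ℝ :=
  ∑ i : Fin n, ∑ k : Fin n,
    if i < k then
      Real.sign (x i - x k) *
        (fderiv ℝ f x (Pi.single i 1) * fderiv ℝ g x (Pi.single k 1) -
         fderiv ℝ f x (Pi.single k 1) * fderiv ℝ g x (Pi.single i 1))
    else 0

/-- The `l`-th element (0-based) of a finset, in increasing order. -/
def elt {n : ℕ} (I : Finset (Fin n)) (l : ℕ) (h : l < I.card) : Fin n :=
  I.orderEmbOfFin rfl ⟨l, h⟩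

/-- `I < J` (interlacing): writing `I = {i₁ < i₂ < ⋯}` and `J = {j₁ < j₂ < ⋯}`,
we require `i₁ < j₁ < i₂ < j₂ < ⋯`. -/
def Interlaces {n : ℕ} (I J : Finset (Fin n)) : Prop :=
  (∀ l (hI : l < I.card) (hJ : l < J.card), elt I l hI < elt J l hJ) ∧
  (∀ l (hJ : l < J.card) (hI : l + 1 < I.card), elt J l hJ < elt I (l + 1) hI)

/-- `Hfun n j m x = H_j(x) = ∑_{I<J, |I|=|J|=j} (∏_{i∈I} mᵢ e^{xᵢ})(∏_{k∈J} mₖ e^{-xₖ})`. -/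
noncomputable def Hfun (n j : ℕ) (m : Fin n → ℝ) (x : Fin n → ℝ) : ℝ :=
  ∑ I : Finset (Fin n), ∑ J : Finset (Fin n),
    if I.card = j ∧ J.card = j ∧ Interlaces I J then
      (∏ i ∈ I, m i * Real.exp (x i)) * (∏ k ∈ J, m k * Real.exp (-x k))
    else 0

/-! ### Interlacing in terms of counting functions -/

/-- The number of elements of `I` below `t`. -/
noncomputable def countBelow {n : ℕ} (t : ℕ) (I : Finset (Fin n)) : ℕ :=
  #(I.filter fun i : Fin n => (i : ℕ) < t)

lemma countBelow_insert {n : ℕ} (t : ℕ) {I : Finset (Fin n)} {a : Fin n} (ha : a ∉ I) :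
    countBelow t (insert a I) = countBelow t I + if (a : ℕ) < t then 1 else 0 := by
  unfold countBelow
  rw [filter_insert]
  split_ifs with h
  · rw [card_insert_of_notMem (by simp [ha])]
  · rfl

lemma countBelow_eq_card {n t : ℕ} {I : Finset (Fin n)} (h : ∀ i ∈ I, (i : ℕ) < t) :
    countBelow t I = #I := by
  unfold countBelow
  rw [filter_true_of_mem h]

lemma elt_mem {n : ℕ} (I : Finset (Fin n)) (l : ℕ) (h : l < #I) : elt I l h ∈ I :=
  I.orderEmbOfFin_mem rfl _

lemma exists_elt_eq {n : ℕ} {I : Finset (Fin n)} {a : Fin n} (ha : a ∈ I) :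
    ∃ l, ∃ h : l < #I, elt I l h = a := by
  have : a ∈ Set.range (I.orderEmbOfFin rfl) := by
    rw [I.range_orderEmbOfFin rfl]
    exact ha
  obtain ⟨l, hl⟩ := this
  exact ⟨l, l.2, hl⟩

lemma elt_le_elt {n : ℕ} {I : Finset (Fin n)} {l l' : ℕ} (h : l < #I) (h' : l' < #I)
    (hl : l ≤ l') : elt I l h ≤ elt I l' h' :=
  (I.orderEmbOfFin rfl).monotone hl

lemma elt_lt_iff {n : ℕ} (I : Finset (Fin n)) (l : ℕ) (h : l < #I) (t : ℕ) :
    (elt I l h : ℕ) < t ↔ l < countBelow t I := by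
  have hcard : countBelow t I =
      #(univ.filter fun i : Fin #I => ((I.orderEmbOfFin rfl i : Fin n) : ℕ) < t) := by
    unfold countBelow
    rw [← card_map (I.orderEmbOfFin rfl).toEmbedding]
    congr 1
    ext a
    simp only [mem_filter, mem_map, mem_univ, true_and]
    constructor
    · rintro ⟨ha, hat⟩
      obtain ⟨l, hl, rfl⟩ := exists_elt_eq ha
      exact ⟨⟨l, hl⟩, hat, rfl⟩
    · rintro ⟨i, hi, rfl⟩
      exact ⟨I.orderEmbOfFin_mem rfl i, hi⟩
  rw [hcard]
  constructor
  · intro hlt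
    have hsub : Iic (⟨l, h⟩ : Fin #I) ⊆
        univ.filter fun i : Fin #I => ((I.orderEmbOfFin rfl i : Fin n) : ℕ) < t := by
      intro i hi
      rw [mem_Iic] at hi
      simp only [mem_filter, mem_univ, true_and]
      exact lt_of_le_of_lt ((I.orderEmbOfFin rfl).monotone hi) hlt
    have := card_le_card hsub
    rw [Fin.card_Iic] at this
    exact this
  · intro hlt
    by_contra hge
    have hsub : (univ.filter fun i : Fin #I => ((I.orderEmbOfFin rfl i : Fin n) : ℕ) < t) ⊆
        Iio (⟨l, h⟩ : Fin #I) := by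
      intro i hi
      simp only [mem_filter, mem_univ, true_and] at hi
      rw [mem_Iio]
      by_contra hi'
      exact hge (lt_of_le_of_lt ((I.orderEmbOfFin rfl).monotone (not_lt.1 hi')) hi)
    have := card_le_card hsub
    rw [Fin.card_Iio] at this
    exact absurd this (not_le.2 hlt)

/-- Two disjoint sets whose elements alternate, starting with an element of `I`. -/
def Alternates {n : ℕ} (I J : Finset (Fin n)) : Prop :=
  Disjoint I J ∧ ∀ t, countBelow t J ≤ countBelow t I ∧ countBelow t I ≤ countBelow t J + 1

lemma Interlaces.alternates {n : ℕ} {I J : Finset (Fin n)} (hcard : #I = #J)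
    (h : Interlaces I J) : Alternates I J := by
  obtain ⟨h₁, h₂⟩ := h
  refine ⟨?_, fun t => ⟨?_, ?_⟩⟩
  · rw [disjoint_left]
    intro a haI haJ
    obtain ⟨l, hl, rfl⟩ := exists_elt_eq haI
    obtain ⟨l', hl', heq⟩ := exists_elt_eq haJ
    rcases le_or_gt l l' with hle | hlt
    · have := (h₁ l hl (by omega)).trans_le (elt_le_elt (by omega) hl' hle)
      exact this.ne heq.symm
    · have := (h₂ l' hl' (by omega)).trans_le (elt_le_elt (by omega) hl hlt)
      exact this.ne heq
  · by_contra hlt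
    have hle : countBelow t J ≤ #J := card_filter_le _ _
    have hJ := (elt_lt_iff J (countBelow t I) (by omega) t).2 (by omega)
    have hI := (elt_lt_iff I (countBelow t I) (by omega) t).1
      (lt_trans (h₁ _ (by omega) (by omega)) hJ)
    exact lt_irrefl _ hI
  · by_contra hlt
    have hle : countBelow t I ≤ #I := card_filter_le _ _
    have hI := (elt_lt_iff I (countBelow t J + 1) (by omega) t).2 (by omega)
    have hJ := (elt_lt_iff J (countBelow t J) (by omega) t).1
      (lt_trans (h₂ _ (by omega) (by omega)) hI)
    exact lt_irrefl _ hJ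

lemma Alternates.interlaces {n : ℕ} {I J : Finset (Fin n)} (h : Alternates I J) :
    Interlaces I J := by
  obtain ⟨hd, h⟩ := h
  refine ⟨fun l hI hJ => ?_, fun l hJ hI => ?_⟩
  · have h1 := (elt_lt_iff J l hJ (elt J l hJ + 1)).1 (Nat.lt_succ_self _)
    have h2 := (elt_lt_iff I l hI (elt J l hJ + 1)).2 (h1.trans_le (h _).1)
    refine lt_of_le_of_ne (Nat.lt_succ_iff.1 h2) fun heq => ?_
    exact disjoint_left.1 hd (elt_mem I l hI) (heq ▸ elt_mem J l hJ)
  · have h1 := (elt_lt_iff I (l + 1) hI (elt I (l + 1) hI + 1)).1 (Nat.lt_succ_self _)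
    have h2 := (elt_lt_iff J l hJ (elt I (l + 1) hI + 1)).2
      (by have := (h (elt I (l + 1) hI + 1)).2; omega)
    refine lt_of_le_of_ne (Nat.lt_succ_iff.1 h2) fun heq => ?_
    exact disjoint_left.1 hd (elt_mem I _ hI) (heq ▸ elt_mem J l hJ)

lemma alternates_insert_right {n : ℕ} {I J : Finset (Fin n)} {a : Fin n}
    (hI : ∀ i ∈ I, i < a) (hJ : ∀ j ∈ J, j < a) :
    Alternates I (insert a J) ↔ Alternates I J ∧ #J < #I := by
  have haI : a ∉ I := fun h => lt_irrefl _ (hI a h)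
  have haJ : a ∉ J := fun h => lt_irrefl _ (hJ a h)
  have cI : ∀ t, (a : ℕ) < t → countBelow t I = #I := fun t ht =>
    countBelow_eq_card fun i hi => lt_trans (hI i hi) ht
  have cJ : ∀ t, (a : ℕ) < t → countBelow t J = #J := fun t ht =>
    countBelow_eq_card fun i hi => lt_trans (hJ i hi) ht
  have kI : countBelow a I = #I := countBelow_eq_card hI
  have kJ : countBelow a J = #J := countBelow_eq_card hJ
  simp only [Alternates, disjoint_insert_right, haI, not_false_eq_true, true_and,
    countBelow_insert _ haJ]
  constructor
  · rintro ⟨hd, h⟩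
    have h0 := h a
    have h1 := h (a + 1)
    rw [cI _ (Nat.lt_succ_self _), cJ _ (Nat.lt_succ_self _)] at h1
    simp only [lt_irrefl, kI, kJ, if_false, Nat.lt_succ_self, if_true] at h0 h1
    refine ⟨⟨hd, fun t => ?_⟩, by omega⟩
    have ht := h t
    split_ifs at ht with hat
    · rw [cI t hat, cJ t hat]; omega
    · exact ht
  · rintro ⟨⟨hd, h⟩, hlt⟩
    refine ⟨hd, fun t => ?_⟩
    have ht := h t
    split_ifs with hat
    · rw [cI t hat, cJ t hat] at ht ⊢; omega
    · exact ht

lemma alternates_insert_left {n : ℕ} {I J : Finset (Fin n)} {a : Fin n}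
    (hI : ∀ i ∈ I, i < a) (hJ : ∀ j ∈ J, j < a) :
    Alternates (insert a I) J ↔ Alternates I J ∧ #I ≤ #J := by
  have haI : a ∉ I := fun h => lt_irrefl _ (hI a h)
  have haJ : a ∉ J := fun h => lt_irrefl _ (hJ a h)
  have cI : ∀ t, (a : ℕ) < t → countBelow t I = #I := fun t ht =>
    countBelow_eq_card fun i hi => lt_trans (hI i hi) ht
  have cJ : ∀ t, (a : ℕ) < t → countBelow t J = #J := fun t ht =>
    countBelow_eq_card fun i hi => lt_trans (hJ i hi) ht
  have kI : countBelow a I = #I := countBelow_eq_card hI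
  have kJ : countBelow a J = #J := countBelow_eq_card hJ
  simp only [Alternates, disjoint_insert_left, haJ, not_false_eq_true, true_and,
    countBelow_insert _ haI]
  constructor
  · rintro ⟨hd, h⟩
    have h0 := h a
    have h1 := h (a + 1)
    rw [cI _ (Nat.lt_succ_self _), cJ _ (Nat.lt_succ_self _)] at h1
    simp only [lt_irrefl, kI, kJ, if_false, Nat.lt_succ_self, if_true] at h0 h1
    refine ⟨⟨hd, fun t => ?_⟩, by omega⟩
    have ht := h t
    split_ifs at ht with hat
    · rw [cI t hat, cJ t hat]; omega
    · exact ht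
  · rintro ⟨⟨hd, h⟩, hlt⟩
    refine ⟨hd, fun t => ?_⟩
    have ht := h t
    split_ifs with hat
    · rw [cI t hat, cJ t hat] at ht ⊢; omega
    · exact ht

lemma Alternates.card_le {n : ℕ} {I J : Finset (Fin n)} (h : Alternates I J) :
    #J ≤ #I ∧ #I ≤ #J + 1 := by
  have := h.2 n
  rwa [countBelow_eq_card fun i _ => i.2, countBelow_eq_card fun i _ => i.2] at this

/-! ### The transfer recursion -/

/-- The generating function of the alternating pairs `(I, J)` of sets of indices below `k` with
`#I = #J + s`, weighted by `c ^ #J ∏_I u ∏_J v`. -/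
noncomputable def altSum {n : ℕ} (u v : Fin n → ℝ) (c : ℝ) (k s : ℕ) : ℝ :=
  ∑ I ∈ (univ.filter fun i : Fin n => (i : ℕ) < k).powerset,
    ∑ J ∈ (univ.filter fun i : Fin n => (i : ℕ) < k).powerset,
      if Alternates I J ∧ #I = #J + s then c ^ #J * ((∏ i ∈ I, u i) * ∏ j ∈ J, v j) else 0

lemma altSum_zero {n : ℕ} (u v : Fin n → ℝ) (c : ℝ) (s : ℕ) :
    altSum u v c 0 s = if s = 0 then 1 else 0 := by
  have : Alternates (∅ : Finset (Fin n)) ∅ := by simp [Alternates, countBelow]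
  simp [altSum, this, eq_comm]

lemma altSum_succ {n : ℕ} (u v : Fin n → ℝ) (c : ℝ) (a : Fin n) (s : ℕ) :
    altSum u v c (a + 1) s = altSum u v c a s +
      (if s = 0 then c * v a * altSum u v c a 1 else 0) +
      (if s = 1 then u a * altSum u v c a 0 else 0) := by
  have hins : (univ.filter fun i : Fin n => (i : ℕ) < a + 1) =
      insert a (univ.filter fun i : Fin n => (i : ℕ) < a) := by
    ext i
    simp only [mem_filter, mem_univ, true_and, mem_insert, Fin.ext_iff]
    omega
  have hnot : a ∉ (univ.filter fun i : Fin n => (i : ℕ) < a) := by simp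
  unfold altSum
  rw [hins]
  simp only [sum_powerset_insert hnot]
  simp only [sum_add_distrib]
  have key : ∀ f : Finset (Fin n) → Finset (Fin n) → ℝ, ∀ g : Finset (Fin n) → Finset (Fin n) → ℝ,
      (∀ I J, (∀ i ∈ I, i < a) → (∀ j ∈ J, j < a) → f I J = g I J) →
      ∑ I ∈ (univ.filter fun i : Fin n => (i : ℕ) < a).powerset,
        ∑ J ∈ (univ.filter fun i : Fin n => (i : ℕ) < a).powerset, f I J =
      ∑ I ∈ (univ.filter fun i : Fin n => (i : ℕ) < a).powerset,
        ∑ J ∈ (univ.filter fun i : Fin n => (i : ℕ) < a).powerset, g I J := by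
    intro f g hfg
    refine sum_congr rfl fun I hI => sum_congr rfl fun J hJ => hfg I J ?_ ?_
    · intro i hi
      simpa using mem_powerset.1 hI hi
    · intro i hi
      simpa using mem_powerset.1 hJ hi
  have hJterm := key
    (fun I J => if Alternates I (insert a J) ∧ #I = #(insert a J) + s then
      c ^ #(insert a J) * ((∏ i ∈ I, u i) * ∏ j ∈ insert a J, v j) else 0)
    (fun I J => if s = 0 then c * v a * (if Alternates I J ∧ #I = #J + 1 then
      c ^ #J * ((∏ i ∈ I, u i) * ∏ j ∈ J, v j) else 0) else 0)
    (by
      intro I J hI hJ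
      have haJ : a ∉ J := fun h => lt_irrefl _ (hJ a h)
      simp only [alternates_insert_right hI hJ, card_insert_of_notMem haJ, prod_insert haJ]
      by_cases hA : Alternates I J
      · have := hA.card_le
        by_cases hs : s = 0
        · subst hs
          by_cases hc : #I = #J + 1
          · simp only [hA, hc]
            simp
            ring
          · have : ¬ (#I = #J + 1 + 0) := by omega
            simp only [this]
            simp
        · have : ¬ (#I = #J + 1 + s) := by omega
          simp [this, hs]
      · simp [hA])
  have hIterm := key
    (fun I J => if Alternates (insert a I) J ∧ #(insert a I) = #J + s then
      c ^ #J * ((∏ i ∈ insert a I, u i) * ∏ j ∈ J, v j) else 0)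
    (fun I J => if s = 1 then u a * (if Alternates I J ∧ #I = #J + 0 then
      c ^ #J * ((∏ i ∈ I, u i) * ∏ j ∈ J, v j) else 0) else 0)
    (by
      intro I J hI hJ
      have haI : a ∉ I := fun h => lt_irrefl _ (hI a h)
      simp only [alternates_insert_left hI hJ, card_insert_of_notMem haI, prod_insert haI]
      by_cases hA : Alternates I J
      · have := hA.card_le
        by_cases hs : s = 1
        · subst hs
          by_cases hc : #I = #J
          · simp only [hA, hc]
            simp
            ring
          · have : ¬ (#I + 1 = #J + 1) := by omega
            simp only [this]
            simp [hc]
        · have : ¬ (#I ≤ #J ∧ #I + 1 = #J + s) := by omega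
          simp [this, hs, and_assoc]
      · simp [hA])
  have hIJterm := key
    (fun I J => if Alternates (insert a I) (insert a J) ∧ #(insert a I) = #(insert a J) + s then
      c ^ #(insert a J) * ((∏ i ∈ insert a I, u i) * ∏ j ∈ insert a J, v j) else 0)
    (fun _ _ => 0)
    (by
      intro I J _ _
      rw [if_neg]
      rintro ⟨⟨hd, -⟩, -⟩
      exact disjoint_left.1 hd (mem_insert_self a I) (mem_insert_self a J))
  rw [hJterm, hIterm, hIJterm]
  split_ifs <;> simp [mul_sum]

lemma sum_pow_mul_Hfun {n : ℕ} (m x : Fin n → ℝ) (c : ℝ) :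
    ∑ j ∈ range (n + 1), c ^ j * Hfun n j m x =
      altSum (fun i => m i * Real.exp (x i)) (fun i => m i * Real.exp (-x i)) c n 0 := by
  unfold Hfun altSum
  have huniv : (univ.filter fun i : Fin n => (i : ℕ) < n) = univ := by ext; simp
  rw [huniv, powerset_univ]
  simp only [mul_sum]
  rw [sum_comm]
  refine sum_congr rfl fun I _ => ?_
  rw [sum_comm]
  refine sum_congr rfl fun J _ => ?_
  have hJ : #J ∈ range (n + 1) := by
    have := card_le_univ J
    rw [Fintype.card_fin] at this
    exact mem_range.2 (Nat.lt_succ_of_le this)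
  rw [sum_eq_single_of_mem (#J) hJ]
  · have : (#I = #J ∧ #J = #J ∧ Interlaces I J) ↔ (Alternates I J ∧ #I = #J + 0) :=
      ⟨fun h => ⟨h.2.2.alternates h.1, h.1⟩, fun h => ⟨h.2, rfl, h.1.interlaces⟩⟩
    rw [if_congr this rfl rfl, mul_ite, mul_zero]
  · intro j _ hj
    rw [if_neg fun h => hj h.2.1.symm, mul_zero]

/-! ### The bracket as a bilinear form on covectors -/

/-- The constant antisymmetric form `∑_{i<k} (φ_i ψ_k - φ_k ψ_i)` on covectors. -/
noncomputable def skewForm {n : ℕ} (φ ψ : (Fin n → ℝ) →L[ℝ] ℝ) : ℝ :=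
  ∑ i : Fin n, ∑ k : Fin n,
    if i < k then φ (Pi.single i 1) * ψ (Pi.single k 1) - φ (Pi.single k 1) * ψ (Pi.single i 1)
    else 0

section skewForm

variable {n : ℕ} (φ φ' ψ : (Fin n → ℝ) →L[ℝ] ℝ)

lemma skewForm_swap : skewForm ψ φ = -skewForm φ ψ := by
  simp only [skewForm, ← sum_neg_distrib]
  refine sum_congr rfl fun i _ => sum_congr rfl fun k _ => ?_
  split_ifs <;> ring

lemma skewForm_add_left : skewForm (φ + φ') ψ = skewForm φ ψ + skewForm φ' ψ := by
  simp only [skewForm, ← sum_add_distrib]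
  refine sum_congr rfl fun i _ => sum_congr rfl fun k _ => ?_
  simp only [add_apply]
  split_ifs <;> ring

lemma skewForm_smul_left (c : ℝ) : skewForm (c • φ) ψ = c * skewForm φ ψ := by
  simp only [skewForm, mul_sum]
  refine sum_congr rfl fun i _ => sum_congr rfl fun k _ => ?_
  simp only [smul_apply, smul_eq_mul]
  split_ifs <;> ring

lemma skewForm_add_right : skewForm ψ (φ + φ') = skewForm ψ φ + skewForm ψ φ' := by
  rw [skewForm_swap, skewForm_add_left, skewForm_swap ψ φ, skewForm_swap ψ φ']
  ring

lemma skewForm_smul_right (c : ℝ) : skewForm ψ (c • φ) = c * skewForm ψ φ := by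
  rw [skewForm_swap, skewForm_smul_left, skewForm_swap ψ φ]
  ring

lemma skewForm_self : skewForm φ φ = 0 := by
  have := skewForm_swap φ φ
  linarith

lemma skewForm_sum_left {ι : Type*} (s : Finset ι) (c : ι → ℝ)
    (F : ι → (Fin n → ℝ) →L[ℝ] ℝ) :
    skewForm (∑ i ∈ s, c i • F i) ψ = ∑ i ∈ s, c i * skewForm (F i) ψ := by
  induction s using Finset.induction_on with
  | empty => simp [skewForm]
  | insert a s ha ih => rw [sum_insert ha, sum_insert ha, skewForm_add_left, skewForm_smul_left, ih]

lemma skewForm_sum_right {ι : Type*} (s : Finset ι) (c : ι → ℝ)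
    (F : ι → (Fin n → ℝ) →L[ℝ] ℝ) :
    skewForm ψ (∑ i ∈ s, c i • F i) = ∑ i ∈ s, c i * skewForm ψ (F i) := by
  rw [skewForm_swap, skewForm_sum_left, ← sum_neg_distrib]
  refine sum_congr rfl fun i _ => ?_
  rw [skewForm_swap ψ (F i)]
  ring

lemma apply_one_eq_sum : φ 1 = ∑ i, φ (Pi.single i 1) := by
  rw [← map_sum]
  congr 1
  ext j
  simp [Finset.sum_apply, Pi.single_apply]

lemma skewForm_proj {a : Fin n} (hφ : ∀ i, a ≤ i → φ (Pi.single i 1) = 0) :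
    skewForm φ (ContinuousLinearMap.proj a) = φ 1 := by
  rw [apply_one_eq_sum, skewForm]
  refine sum_congr rfl fun i _ => ?_
  rw [sum_eq_single_of_mem a (mem_univ a)]
  · simp only [ContinuousLinearMap.proj_apply, Pi.single_apply]
    rcases lt_or_ge i a with h | h
    · simp [h, h.ne']
    · simp [h.not_gt, hφ i h]
  · intro k _ hk
    simp only [ContinuousLinearMap.proj_apply, Pi.single_apply, hk.symm, if_false]
    split_ifs with h1 h2
    · rw [hφ k (h2 ▸ h1.le)]; simp
    · simp
    · rfl

end skewForm

lemma pb_eq_neg_skewForm {n : ℕ} (f g : (Fin n → ℝ) → ℝ) {x : Fin n → ℝ} (hx : StrictMono x) :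
    pb f g x = -skewForm (fderiv ℝ f x) (fderiv ℝ g x) := by
  simp only [pb, skewForm, ← sum_neg_distrib]
  refine sum_congr rfl fun i _ => sum_congr rfl fun k _ => ?_
  split_ifs with h
  · rw [Real.sign_of_neg (sub_neg.2 (hx h))]; ring
  · simp

/-- The brackets of the partial generating functions `altSum · · c k 0` and `altSum · · c k 1`
at two values of the spectral parameter `c` close among themselves. -/
lemma exists_hasFDerivAt_altSum {n : ℕ} (m x : Fin n → ℝ) (S : ℝ → ℕ → ℕ → (Fin n → ℝ) → ℝ)
    (hS : ∀ c k s, S c k s = fun y =>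
      altSum (fun i => m i * Real.exp (y i)) (fun i => m i * Real.exp (-y i)) c k s)
    (k : ℕ) (hk : k ≤ n) :
    ∃ P Q : ℝ → (Fin n → ℝ) →L[ℝ] ℝ,
      (∀ c, HasFDerivAt (S c k 0) (P c) x ∧ HasFDerivAt (S c k 1) (Q c) x ∧
        (∀ i : Fin n, k ≤ i → P c (Pi.single i 1) = 0 ∧ Q c (Pi.single i 1) = 0) ∧
        P c 1 = 0 ∧ Q c 1 = S c k 1 x) ∧
      ∀ c d, c ≠ d → skewForm (P c) (P d) = 0 ∧ skewForm (Q c) (Q d) = 0 ∧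
        (c - d) * skewForm (P c) (Q d) =
          c * (S c k 0 x * S d k 1 x - S c k 1 x * S d k 0 x) := by
  induction k with
  | zero =>
    refine ⟨0, 0, fun c => ⟨?_, ?_, by simp, by simp, ?_⟩, fun c d _ => ?_⟩
    · simp only [hS, altSum_zero]
      exact hasFDerivAt_const _ _
    · simp only [hS, altSum_zero]
      exact hasFDerivAt_const _ _
    · simp [hS, altSum_zero]
    · simp [hS, altSum_zero, skewForm]
  | succ k ih =>
    obtain ⟨P, Q, h, hb⟩ := ih (Nat.le_of_succ_le hk)
    set a : Fin n := ⟨k, hk⟩ with ha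
    set u : ℝ := m a * Real.exp (x a) with hu
    set v : ℝ := m a * Real.exp (-x a) with hv
    set E : (Fin n → ℝ) →L[ℝ] ℝ := ContinuousLinearMap.proj a with hE
    have hS0 : ∀ c, S c (k + 1) 0 =
        fun y => S c k 0 y + c * ((m a * Real.exp (-y a)) * S c k 1 y) := by
      intro c
      ext y
      have := altSum_succ (fun i => m i * Real.exp (y i)) (fun i => m i * Real.exp (-y i)) c a 0
      simp only [hS]
      simp only [ha] at this ⊢
      rw [this]
      simp
      ring
    have hS1 : ∀ c, S c (k + 1) 1 =
        fun y => S c k 1 y + (m a * Real.exp (y a)) * S c k 0 y := by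
      intro c
      ext y
      have := altSum_succ (fun i => m i * Real.exp (y i)) (fun i => m i * Real.exp (-y i)) c a 1
      simp only [hS]
      simp only [ha] at this ⊢
      rw [this]
      simp
    have hEx : HasFDerivAt (fun y : Fin n → ℝ => y a) E x := E.hasFDerivAt
    have hU : HasFDerivAt (fun y : Fin n → ℝ => m a * Real.exp (y a)) (u • E) x := by
      have := hEx.exp.const_mul (m a)
      rwa [smul_smul] at this
    have hV : HasFDerivAt (fun y : Fin n → ℝ => m a * Real.exp (-y a)) ((-v) • E) x := by
      have := hEx.fun_neg.exp.const_mul (m a)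
      rwa [smul_neg, smul_neg, smul_smul, ← neg_smul] at this
    have hE1 : E 1 = 1 := rfl
    have hPE : ∀ c, skewForm (P c) E = 0 := fun c => by
      rw [hE, skewForm_proj _ fun i hi => ((h c).2.2.1 i hi).1, (h c).2.2.2.1]
    have hQE : ∀ c, skewForm (Q c) E = S c k 1 x := fun c => by
      rw [hE, skewForm_proj _ fun i hi => ((h c).2.2.1 i hi).2, (h c).2.2.2.2]
    have hEP : ∀ c, skewForm E (P c) = 0 := fun c => by rw [skewForm_swap, hPE, neg_zero]
    have hEQ : ∀ c, skewForm E (Q c) = -S c k 1 x := fun c => by rw [skewForm_swap, hQE]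
    refine ⟨fun c => P c + c • (v • Q c + S c k 1 x • (-v) • E),
      fun c => Q c + (u • P c + S c k 0 x • u • E), fun c => ⟨?_, ?_, ?_, ?_, ?_⟩,
      fun c d hcd => ?_⟩
    · rw [hS0]
      exact (h c).1.add ((hV.mul (h c).2.1).const_mul c)
    · rw [hS1]
      exact (h c).2.1.add (hU.mul (h c).1)
    · intro i hi
      have hne : a ≠ i := by
        intro hai
        have : k = i := congrArg Fin.val hai
        omega
      have hEi : E (Pi.single i 1) = 0 := by simp [hE, hne]
      have := (h c).2.2.1 i (by omega)
      simp [this.1, this.2, hEi]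
    · simp [hE1, (h c).2.2.2.1, (h c).2.2.2.2]
      ring
    · rw [hS1]
      simp [hE1, (h c).2.2.2.1, (h c).2.2.2.2]
      ring
    · obtain ⟨h1, h2, h3⟩ := hb c d hcd
      obtain ⟨-, -, h4⟩ := hb d c hcd.symm
      have hQP : skewForm (Q c) (P d) = -skewForm (P d) (Q c) := skewForm_swap _ _
      have hsub : c - d ≠ 0 := sub_ne_zero.2 hcd
      simp only [hS0, hS1, ← hu, ← hv]
      simp only [skewForm_add_left, skewForm_add_right, skewForm_smul_left, skewForm_smul_right,
        hPE, hQE, hEP, hEQ, h1, h2, skewForm_self, hQP]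
      refine ⟨?_, ?_, ?_⟩
      · apply mul_left_cancel₀ hsub
        linear_combination d * v * h3 + c * v * h4
      · apply mul_left_cancel₀ hsub
        linear_combination u * h3 + u * h4
      · linear_combination h3 + c * v * u * h4

lemma differentiable_Hfun (n j : ℕ) (m : Fin n → ℝ) : Differentiable ℝ (Hfun n j m) := by
  unfold Hfun
  refine Differentiable.fun_sum fun I _ => Differentiable.fun_sum fun J _ => ?_
  split_ifs
  · fun_prop
  · fun_prop

lemma eq_zero_of_sum_pow_mul_eq_zero {N : ℕ} {f : ℕ → ℝ} (d : ℝ)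
    (h : ∀ c, c ≠ d → ∑ i ∈ range N, c ^ i * f i = 0) {i : ℕ} (hi : i < N) : f i = 0 := by
  have hp : (∑ i ∈ range N, Polynomial.monomial i (f i)) = 0 := by
    refine Polynomial.eq_zero_of_infinite_isRoot _
      ((Set.finite_singleton d).infinite_compl.mono fun c hc => ?_)
    simp only [Set.mem_ofPred_eq, Polynomial.IsRoot.def, Polynomial.eval_finsetSum,
      Polynomial.eval_monomial]
    rw [← h c hc]
    exact sum_congr rfl fun i _ => mul_comm _ _
  have := congrArg (fun p => Polynomial.coeff p i) hp
  simpa [Polynomial.finsetSum_coeff, Polynomial.coeff_monomial, hi] using this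

theorem skewForm_fderiv_Hfun {n i j : ℕ} (m x : Fin n → ℝ) (hi : i < n + 1) (hj : j < n + 1) :
    skewForm (fderiv ℝ (Hfun n i m) x) (fderiv ℝ (Hfun n j m) x) = 0 := by
  obtain ⟨P, Q, hP, hb⟩ := exists_hasFDerivAt_altSum m x _ (fun _ _ _ => rfl) n le_rfl
  have hPc : ∀ c, P c = ∑ j ∈ range (n + 1), c ^ j • fderiv ℝ (Hfun n j m) x := by
    intro c
    refine (hP c).1.unique ?_
    simp only [← sum_pow_mul_Hfun]
    exact HasFDerivAt.fun_sum fun j _ =>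
      ((differentiable_Hfun n j m) x).hasFDerivAt.const_mul (c ^ j)
  have hsum : ∀ d c, c ≠ d → ∑ i ∈ range (n + 1), c ^ i *
      ∑ j ∈ range (n + 1), d ^ j *
        skewForm (fderiv ℝ (Hfun n i m) x) (fderiv ℝ (Hfun n j m) x) = 0 := by
    intro d c hcd
    rw [← (hb c d hcd).1, hPc, hPc, skewForm_sum_left]
    simp only [skewForm_sum_right]
  exact eq_zero_of_sum_pow_mul_eq_zero 0
    (fun d _ => eq_zero_of_sum_pow_mul_eq_zero d (hsum d) hi) hj

theorem statement6 (K : ℕ) (hK : 1 ≤ K) (m : Fin (2 * K + 1) → ℝ) (hm : ∀ i, 0 < m i)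
    (i j : ℕ) (hi : 1 ≤ i) (hi' : i ≤ K) (hj : 1 ≤ j) (hj' : j ≤ K)
    (x : Fin (2 * K + 1) → ℝ) (hx : StrictMono x) :
    pb (Hfun (2 * K + 1) i m) (Hfun (2 * K + 1) j m) x = 0 := by
  rw [pb_eq_neg_skewForm _ _ hx, skewForm_fderiv_Hfun m x (by omega) (by omega), neg_zero]
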